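/- Let n ≥ 1 and k ≥ 1, and let h_1, …, h_{nk} ∈ {0,1}^k. In the polynomial ring (ℤ/2)[u_1, …, u_k], suppose that the product ∏_{i=1}^{nk} (h_{i,1} u_1 + ⋯ + h_{i,k} u_k) is congruent to u_1^n u_2^n ⋯ u_k^n modulo the ideal generated by u_1^{n+1}, …, u_k^{n+1}. Let S^n denote the unit sphere in ℝ^{n+1}. Then every continuous map f = (f_1, …, f_{nk}) : (S^n)^k → ℝ^{nk} satisfying f_i(ε_1 y_1, …, ε_k y_k) = (∏_{j : h_{i,j} = 1} ε_j) · f_i(y_1, …, y_k) for all i ∈ [nk], all signs ε_1, …, ε_k ∈ {−1, 1}, and all (y_1, …, y_k) ∈ (S^n)^k, has a zero, i.e., there exists y ∈ (S^n)^k with f(y) = 0. -/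

import Mathlib

open MvPolynomial

namespace BU
variable {k n : ℕ}

abbrev Cl (k n : ℕ) := Fin k × Fin (n+1) → ℤ

def Step (x y : Cl k n) : Prop :=
  ∃ i, ∃ d : ℤ, (d = 1 ∨ d = -1) ∧ Even (x i) ∧ y = Function.update x i (x i + d)

def Le (x y : Cl k n) : Prop :=
  ∀ i, x i = y i ∨ (Even (x i) ∧ Odd (y i) ∧ (y i = x i + 1 ∨ y i = x i - 1))

def Top (M : ℤ) (x : Cl k n) : Prop :=
  ∀ j, ∃ q, |x (j,q)| = M ∧ ∀ p, p ≠ q → Odd (x (j,p)) ∧ |x (j,p)| < M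

structure Flag (M : ℤ) (N : ℕ) (c : ℕ → Cl k n) : Prop where
  zero : ∀ i, Even (c 0 i)
  step : ∀ r < N, Step (c r) (c (r+1))
  top : Top M (c N)
  out : ∀ r, N < r → c r = 0

theorem odd_add_d {a d : ℤ} (hd : d = 1 ∨ d = -1) (ha : Even a) : Odd (a + d) := by
  rcases hd with rfl | rfl <;> grind

theorem Step.le {x y : Cl k n} (h : Step x y) : Le x y := by
  obtain ⟨i, d, hd, he, rfl⟩ := h
  intro i'
  by_cases hi : i' = i
  · subst hi
    right
    simp only [Function.update_self]
    exact ⟨he, odd_add_d hd he, by grind⟩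
  · left; simp [hi]

theorem Le.refl (x : Cl k n) : Le x x := fun _ => Or.inl rfl

theorem Le.trans {x y z : Cl k n} (h : Le x y) (h' : Le y z) : Le x z := by
  intro i
  have := h i
  have := h' i
  grind

theorem Flag.le {M : ℤ} {N : ℕ} {c : ℕ → Cl k n} (hc : Flag M N c) {r s : ℕ} (h : r ≤ s)
    (hs : s ≤ N) : Le (c r) (c s) := by
  induction s, h using Nat.le_induction with
  | base => exact Le.refl _
  | succ s h ih => exact (ih (by omega)).trans (hc.step s (by omega)).le

theorem step_zero_thin {x y : Cl k n} (hx : ∀ i, Even (x i)) (h : Step x y) :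
    ∃ x', x' ≠ x ∧ (∀ i, Even (x' i)) ∧ Step x' y ∧
      ∀ x'', (∀ i, Even (x'' i)) → Step x'' y → x'' = x ∨ x'' = x' := by
  obtain ⟨i, d, hd, he, rfl⟩ := h
  refine ⟨Function.update x i (x i + 2 * d), ?_, ?_, ?_, ?_⟩
  · intro h
    have := congrFun h i
    simp at this
    omega
  · intro i'
    by_cases hi : i' = i
    · subst hi
      simp only [Function.update_self]
      grind
    · simp [hi, hx]
  · refine ⟨i, -d, by omega, ?_, ?_⟩
    · simp only [Function.update_self]
      grind
    · simp only [Function.update_self, Function.update_idem]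
      congr 1
      ring
  · rintro x'' hx'' ⟨i', d', hd', he', hy⟩
    have hii : i' = i := by
      by_contra hne
      have h1 := congrFun hy i'
      simp [hne] at h1
      have := hx i'
      have := odd_add_d hd' he'
      grind
    subst hii
    have h1 := congrFun hy i'
    simp at h1
    have h2 : ∀ a, a ≠ i' → x'' a = x a := by
      intro a ha
      have := congrFun hy a
      simpa [ha] using this.symm
    by_cases hdd : d' = d
    · left
      funext a
      by_cases ha : a = i'
      · subst ha; omega
      · exact h2 a ha
    · right
      funext a
      by_cases ha : a = i'
      · subst ha; simp; omega
      · simp [ha, h2 a ha]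

theorem step_mid_thin {x y z : Cl k n} (h : Step x y) (h' : Step y z) :
    ∃ y', y' ≠ y ∧ Step x y' ∧ Step y' z ∧
      ∀ y'', Step x y'' → Step y'' z → y'' = y ∨ y'' = y' := by
  obtain ⟨i, d, hd, he, rfl⟩ := h
  obtain ⟨j, e, hde, hej, rfl⟩ := h'
  have hij : j ≠ i := by
    rintro rfl
    simp only [Function.update_self] at hej
    have := odd_add_d hd he
    grind
  simp only [Function.update_of_ne hij] at hej
  refine ⟨Function.update x j (x j + e), ?_, ⟨j, e, hde, hej, rfl⟩, ⟨i, d, hd, ?_, ?_⟩, ?_⟩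
  · intro h
    have := congrFun h i
    simp [hij.symm] at this
    omega
  · simpa [hij.symm] using he
  · simp only [Function.update_of_ne hij, Function.update_of_ne hij.symm]
    rw [Function.update_comm hij]
  · rintro y'' ⟨a, f, hf, hea, rfl⟩ ⟨b, g, hg, heb, hz⟩
    have hab : b ≠ a := by
      rintro rfl
      simp only [Function.update_self] at heb
      have := odd_add_d hf hea
      grind
    have h1 := congrFun hz a
    simp [hab.symm, hij] at h1
    by_cases hai : a = i
    · subst hai
      left
      simp [hij.symm] at h1
      rw [h1]
    · by_cases haj : a = j
      · subst haj
        right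
        simp at h1
        rw [h1]
      · simp [hai, haj] at h1
        omega

theorem step_top_thin {M : ℤ} (hM : Even M) (hM0 : 0 < M) {x y : Cl k n} (h : Step x y)
    (hy : Top M y) :
    ∃ y', y' ≠ y ∧ Step x y' ∧ Top M y' ∧
      ∀ y'', Step x y'' → Top M y'' → y'' = y ∨ y'' = y' := by
  obtain ⟨⟨j, p⟩, d, hd, he, rfl⟩ := h
  have hodd := odd_add_d hd he
  obtain ⟨q, hq, hq'⟩ := hy j
  have hqp : q ≠ p := by
    rintro rfl
    simp only [Function.update_self] at hq
    grind
  have hqM : |x (j,q)| = M := by simpa [hqp] using hq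
  have hpM : |x (j,p) + d| < M := by simpa using (hq' p hqp.symm).2
  have hoth : ∀ a, a ≠ q → a ≠ p → Odd (x (j,a)) ∧ |x (j,a)| < M := by
    intro a ha ha'
    simpa [ha'] using hq' a ha
  have hfac : ∀ b, b ≠ j → ∃ q, |x (b,q)| = M ∧ ∀ p, p ≠ q → Odd (x (b,p)) ∧ |x (b,p)| < M := by
    intro b hb
    simpa [hb] using hy b
  -- location of any other top coface
  have hloc : ∀ i'' : Fin k × Fin (n+1), ∀ d'' : ℤ, (d'' = 1 ∨ d'' = -1) → Even (x i'') →
      Top M (Function.update x i'' (x i'' + d'')) → i'' = (j,p) ∨ i'' = (j,q) := by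
    rintro ⟨b, a⟩ d'' hd'' he'' ht
    by_cases hb : b = j
    · subst hb
      by_contra hcon
      push Not at hcon
      have := (hoth a (by grind) (by grind)).1
      grind
    · exfalso
      obtain ⟨q2, h1, h2⟩ := hfac b hb
      have haq : a = q2 := by
        by_contra hne
        have := (h2 a hne).1
        grind
      subst haq
      obtain ⟨q3, h3, h4⟩ := ht b
      by_cases h5 : q3 = a
      · subst h5
        simp only [Function.update_self] at h3
        have := odd_add_d hd'' he''
        grind
      · have h6 : |x (b,q3)| = M := by simpa [h5] using h3
        have := (h2 q3 h5).2
        omega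
  by_cases hcase : |x (j,p)| < M
  · refine ⟨Function.update x (j,p) (x (j,p) + (-d)), ?_, ⟨(j,p), -d, by omega, he, rfl⟩, ?_, ?_⟩
    · intro h
      have := congrFun h (j,p)
      simp at this
      omega
    · intro b
      by_cases hb : b = j
      · subst hb
        refine ⟨q, by simpa [hqp] using hqM, ?_⟩
        intro a ha
        by_cases hap : a = p
        · subst hap
          simp only [Function.update_self]
          refine ⟨odd_add_d (by omega) he, ?_⟩
          have : x (b,a) ≠ M - 1 := by grind
          have : x (b,a) ≠ -M + 1 := by grind
          rw [abs_lt] at *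
          omega
        · simpa [hap] using hoth a ha hap
      · simpa [hb] using hfac b hb
    · rintro y'' ⟨i'', d'', hd'', he'', rfl⟩ ht
      rcases hloc i'' d'' hd'' he'' ht with rfl | rfl
      · by_cases hdd : d'' = d
        · left; rw [hdd]
        · right
          have : d'' = -d := by omega
          rw [this]
      · exfalso
        obtain ⟨q3, h3, h4⟩ := ht j
        by_cases h5 : q3 = q
        · subst h5
          simp only [Function.update_self] at h3
          have := odd_add_d hd'' he''
          grind
        · have h6 : |x (j,q3)| = M := by simpa [h5] using h3
          by_cases h7 : q3 = p
          · subst h7; omega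
          · have := (hoth q3 h5 h7).2
            omega
  · have hpe : |x (j,p)| = M := by
      grind
    obtain ⟨d', hd', hd'M⟩ : ∃ d' : ℤ, (d' = 1 ∨ d' = -1) ∧ |x (j,q) + d'| < M := by
      by_cases hs : 0 < x (j,q)
      · exact ⟨-1, by simp, by grind⟩
      · exact ⟨1, by simp, by grind⟩
    have hqe : Even (x (j,q)) := by
      grind
    refine ⟨Function.update x (j,q) (x (j,q) + d'), ?_, ⟨(j,q), d', hd', hqe, rfl⟩, ?_, ?_⟩
    · intro h
      have := congrFun h (j,p)
      simp [hqp.symm] at this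
      omega
    · intro b
      by_cases hb : b = j
      · subst hb
        refine ⟨p, by simpa [hqp.symm] using hpe, ?_⟩
        intro a ha
        by_cases hap : a = q
        · subst hap
          simp only [Function.update_self]
          exact ⟨odd_add_d hd' hqe, hd'M⟩
        · simpa [hap] using hoth a hap ha
      · simpa [hb] using hfac b hb
    · rintro y'' ⟨i'', d'', hd'', he'', rfl⟩ ht
      have hle : |x i'' + d''| ≤ M := by
        obtain ⟨q3, h3, h4⟩ := ht i''.1
        by_cases h5 : q3 = i''.2
        · subst h5
          simp at h3
          exact h3.le
        · have := (h4 i''.2 (Ne.symm h5)).2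
          simp at this
          exact this.le
      rcases hloc i'' d'' hd'' he'' ht with rfl | rfl
      · left
        have : d'' = d := by grind
        rw [this]
      · right
        have : d'' = d' := by grind
        rw [this]

theorem Flag.update {M : ℤ} {N : ℕ} {c : ℕ → Cl k n} (hc : Flag M N c) {r : ℕ} (hr : r ≤ N)
    {y : Cl k n} (h0 : r = 0 → ∀ i, Even (y i)) (h1 : 0 < r → Step (c (r-1)) y)
    (h2 : r < N → Step y (c (r+1))) (h3 : r = N → Top M y) :
    Flag M N (Function.update c r y) where
  zero := by
    by_cases h : r = 0
    · subst h; simpa using h0 rfl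
    · rw [Function.update_of_ne (Ne.symm h)]; exact hc.zero
  step := by
    intro s hs
    by_cases h : s = r
    · subst h
      simpa using h2 hs
    · by_cases h' : s + 1 = r
      · subst h'
        simpa using h1 (by omega)
      · rw [Function.update_of_ne h, Function.update_of_ne h']
        exact hc.step s hs
  top := by
    by_cases h : r = N
    · subst h; simpa using h3 rfl
    · rw [Function.update_of_ne (Ne.symm h)]; exact hc.top
  out := by
    intro s hs
    rw [Function.update_of_ne (by omega)]; exact hc.out s hs

theorem Flag.thin {M : ℤ} (hM : Even M) (hM0 : 0 < M) {N : ℕ} (hN : 1 ≤ N) {c : ℕ → Cl k n}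
    (hc : Flag M N c) {r : ℕ} (hr : r ≤ N) :
    ∃ c', Flag M N c' ∧ c' ≠ c ∧ (∀ s, s ≠ r → c' s = c s) ∧
      ∀ c'', Flag M N c'' → (∀ s, s ≠ r → c'' s = c s) → c'' = c ∨ c'' = c' := by
  suffices H : ∃ y, y ≠ c r ∧ Flag M N (Function.update c r y) ∧
      ∀ c'', Flag M N c'' → (∀ s, s ≠ r → c'' s = c s) → c'' r = c r ∨ c'' r = y by
    obtain ⟨y, hy, hf, hu⟩ := H
    refine ⟨_, hf, ?_, ?_, ?_⟩
    · intro h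
      have := congrFun h r
      simp at this
      exact hy this
    · intro s hs
      simp [hs]
    · intro c'' hc'' hag
      rcases hu c'' hc'' hag with h | h
      · left
        funext s
        by_cases hs : s = r
        · rw [hs, h]
        · exact hag s hs
      · right
        funext s
        by_cases hs : s = r
        · rw [hs, h]; simp
        · rw [hag s hs]; simp [hs]
  by_cases h0 : r = 0
  · subst h0
    obtain ⟨x', h1, h2, h3, h4⟩ := step_zero_thin hc.zero (hc.step 0 (by omega))
    refine ⟨x', h1, hc.update hr (fun _ => h2) (by omega) (fun _ => h3) (by omega), ?_⟩
    intro c'' hc'' hag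
    refine h4 _ hc''.zero ?_
    have := hc''.step 0 (by omega)
    rwa [hag (0+1) (by omega)] at this
  · by_cases hN' : r = N
    · subst hN'
      obtain ⟨s, rfl⟩ : ∃ s, r = s + 1 := ⟨r - 1, by omega⟩
      obtain ⟨x', h1, h2, h3, h4⟩ := step_top_thin hM hM0 (hc.step s (by omega)) hc.top
      refine ⟨x', h1, hc.update hr (by omega) (fun _ => h2) (by omega) (fun _ => h3), ?_⟩
      intro c'' hc'' hag
      refine h4 _ ?_ hc''.top
      have := hc''.step s (by omega)
      rwa [hag s (by omega)] at this
    · obtain ⟨s, rfl⟩ : ∃ s, r = s + 1 := ⟨r - 1, by omega⟩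
      obtain ⟨x', h1, h2, h3, h4⟩ := step_mid_thin (hc.step s (by omega)) (hc.step (s+1) (by omega))
      refine ⟨x', h1, hc.update hr (by omega) (fun _ => h2) (fun _ => h3) (by omega), ?_⟩
      intro c'' hc'' hag
      refine h4 _ ?_ ?_
      · have := hc''.step s (by omega)
        rwa [hag s (by omega)] at this
      · have := hc''.step (s+1) (by omega)
        rwa [hag (s+1+1) (by omega)] at this

end BU
namespace BU
variable {k n : ℕ}

def act (g : Fin k → ZMod 2) (x : Cl k n) : Cl k n := fun i => if g i.1 = 0 then x i else - x i

def V (M : ℤ) (x : Cl k n) : Prop := ∀ j, (∀ p, |x (j,p)| ≤ M) ∧ ∃ p, |x (j,p)| = M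

theorem zmod2_cases (a : ZMod 2) : a = 0 ∨ a = 1 := by
  revert a; decide

theorem act_zero (x : Cl k n) : act 0 x = x := by
  funext i; simp [act]

theorem act_act (g g' : Fin k → ZMod 2) (x : Cl k n) : act g (act g' x) = act (g + g') x := by
  funext i
  simp only [act, Pi.add_apply]
  rcases zmod2_cases (g i.1) with h | h <;> rcases zmod2_cases (g' i.1) with h' | h' <;>
    simp [h, h', show (1 + 1 : ZMod 2) = 0 from by decide]

theorem add_self_fun (g : Fin k → ZMod 2) : g + g = 0 := by
  funext j
  exact CharTwo.add_self_eq_zero _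

theorem abs_act (g : Fin k → ZMod 2) (x : Cl k n) (i) : |act g x i| = |x i| := by
  simp only [act]; split_ifs <;> simp

theorem even_act (g : Fin k → ZMod 2) (x : Cl k n) (i) : Even (act g x i) ↔ Even (x i) := by
  simp only [act]; split_ifs <;> simp

theorem odd_act (g : Fin k → ZMod 2) (x : Cl k n) (i) : Odd (act g x i) ↔ Odd (x i) := by
  simp only [act]; split_ifs <;> simp

theorem V.act {M : ℤ} {x : Cl k n} (h : V M x) (g : Fin k → ZMod 2) : V M (act g x) := by
  intro j
  simpa [abs_act] using h j

theorem Top.act {M : ℤ} {x : Cl k n} (h : Top M x) (g : Fin k → ZMod 2) : Top M (act g x) := by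
  intro j
  simpa only [abs_act, odd_act] using h j

theorem Step.act {x y : Cl k n} (h : Step x y) (g : Fin k → ZMod 2) :
    Step (act g x) (act g y) := by
  obtain ⟨i, d, hd, he, rfl⟩ := h
  refine ⟨i, if g i.1 = 0 then d else -d, by split_ifs <;> omega, (even_act _ _ _).2 he, ?_⟩
  funext a
  by_cases ha : a = i
  · subst ha
    simp only [BU.act, Function.update_self]
    split_ifs <;> ring
  · simp [BU.act, ha]

def actF (g : Fin k → ZMod 2) (c : ℕ → Cl k n) : ℕ → Cl k n := fun r => act g (c r)

theorem Flag.actF {M : ℤ} {N : ℕ} {c : ℕ → Cl k n} (hc : Flag M N c) (g : Fin k → ZMod 2) :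
    Flag M N (actF g c) where
  zero := fun i => (even_act _ _ _).2 (hc.zero i)
  step := fun r hr => (hc.step r hr).act g
  top := hc.top.act g
  out := fun r hr => by
    have := hc.out r hr
    funext i
    simp [BU.actF, this, act]

theorem actF_actF (g g' : Fin k → ZMod 2) (c : ℕ → Cl k n) :
    actF g (actF g' c) = actF (g + g') c := by
  funext r; exact act_act _ _ _

theorem actF_zero (c : ℕ → Cl k n) : actF 0 c = c := by
  funext r; exact act_zero _

theorem Flag.V {M : ℤ} (hM : Even M) {N : ℕ} {c : ℕ → Cl k n} (hc : Flag M N c)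
    {r : ℕ} (hr : r ≤ N) : V M (c r) := by
  have hle := hc.le hr le_rfl
  intro j
  obtain ⟨q, h1, h2⟩ := hc.top j
  constructor
  · intro p
    have h3 := hle (j,p)
    by_cases hp : p = q
    · subst hp
      grind
    · have := h2 p hp
      grind
  · refine ⟨q, ?_⟩
    have h3 := hle (j,q)
    grind

/-- the constant coordinate in each factor -/
theorem Flag.const {M : ℤ} (hM : Even M) {N : ℕ} {c : ℕ → Cl k n} (hc : Flag M N c)
    {i : Fin k × Fin (n+1)} (hi : |c N i| = M) {r : ℕ} (hr : r ≤ N) : c r i = c N i := by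
  have hle := hc.le hr le_rfl i
  grind

def lv (j : Fin k) (x : Cl k n) : Lex (Fin (n+1) → ℤ) := toLex (fun p => x (j,p))

open Classical in
noncomputable def tau (j : Fin k) (x : Cl k n) : ZMod 2 :=
  if lv j x < 0 then 1 else 0

theorem tau_one {j : Fin k} {x : Cl k n} (h : lv j x < 0) : tau j x = 1 := if_pos h

theorem tau_zero {j : Fin k} {x : Cl k n} (h : ¬ lv j x < 0) : tau j x = 0 := if_neg h

def Equi (M : ℤ) (a : Fin k → ZMod 2) (s : Cl k n → ZMod 2) : Prop :=
  ∀ x, V M x → ∀ g, s (act g x) = s x + ∑ j, a j * g j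

theorem tau_act {M : ℤ} (hM0 : 0 < M) {x : Cl k n} (hx : V M x) (g : Fin k → ZMod 2) (j : Fin k) :
    tau j (act g x) = tau j x + g j := by
  rcases zmod2_cases (g j) with h | h
  · have h1 : lv j (act g x) = lv j x := by
      funext p
      change act g x (j,p) = x (j,p)
      simp only [act, h, if_true]
    rw [h, add_zero]
    by_cases h2 : lv j x < 0
    · rw [tau_one h2, tau_one (by rwa [h1])]
    · rw [tau_zero h2, tau_zero (by rwa [h1])]
  · have h1 : lv j (act g x) = - lv j x := by
      funext p
      change act g x (j,p) = - x (j,p)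
      simp [act, h]
    have h2 : lv j x ≠ 0 := by
      intro h0
      obtain ⟨p, hp⟩ := (hx j).2
      have : x (j,p) = 0 := congrFun h0 p
      rw [this] at hp
      simp at hp
      omega
    rw [h]
    rcases lt_or_gt_of_ne h2 with h3 | h3
    · rw [tau_one h3, tau_zero (by rw [h1]; exact not_lt.2 (neg_nonneg.2 h3.le))]
      decide
    · rw [tau_zero (not_lt.2 h3.le), tau_one (by rw [h1]; exact neg_lt_zero.2 h3)]
      decide

theorem act_eq_self {M : ℤ} (hM0 : 0 < M) {x : Cl k n} (hx : V M x) {g : Fin k → ZMod 2}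
    (h : act g x = x) : g = 0 := by
  funext j
  have := tau_act hM0 hx g j
  rw [h] at this
  simpa using this

theorem flags_finite (M : ℤ) (hM : Even M) (N : ℕ) :
    {c : ℕ → Cl k n | Flag M N c}.Finite := by
  have hfin : (Set.pi Set.univ fun _ : Fin (N+1) =>
      (Set.pi Set.univ fun _ : Fin k × Fin (n+1) => Set.Icc (-M) M)).Finite :=
    Set.Finite.pi fun _ => Set.Finite.pi fun _ => Set.finite_Icc _ _
  refine Set.Finite.of_finite_image (f := fun c (r : Fin (N+1)) => c r) (hfin.subset ?_) ?_
  · rintro _ ⟨c, hc, rfl⟩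
    intro r _ i _
    have := (Flag.V hM hc (Nat.lt_succ_iff.1 r.2) i.1).1 i.2
    exact abs_le.1 this
  · intro c hc c' hc' h
    funext r
    by_cases hr : r ≤ N
    · exact congrFun h ⟨r, by omega⟩
    · rw [Flag.out hc r (by omega), Flag.out hc' r (by omega)]

noncomputable def R (k n : ℕ) (M : ℤ) (hM : Even M) (N : ℕ) : Finset (ℕ → Cl k n) :=
  ((flags_finite (k := k) (n := n) M hM N).subset
    (show {c : ℕ → Cl k n | Flag M N c ∧ ∀ j, tau j (c N) = 0} ⊆ _ from fun _ h => h.1)).toFinset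

theorem mem_R {M : ℤ} {hM : Even M} {N : ℕ} {c : ℕ → Cl k n} :
    c ∈ R k n M hM N ↔ Flag M N c ∧ ∀ j, tau j (c N) = 0 := by
  simp [R]

noncomputable def nor (N : ℕ) (c : ℕ → Cl k n) : ℕ → Cl k n := actF (fun j => tau j (c N)) c

theorem nor_mem {M : ℤ} {hM : Even M} (hM0 : 0 < M) {N : ℕ} {c : ℕ → Cl k n} (hc : Flag M N c) :
    nor N c ∈ R k n M hM N := by
  rw [mem_R]
  refine ⟨hc.actF _, fun j => ?_⟩
  have := tau_act hM0 (hc.V hM le_rfl) (fun j => tau j (c N)) j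
  simp only [nor, actF, this]
  exact CharTwo.add_self_eq_zero _

theorem nor_of_mem {M : ℤ} {hM : Even M} {N : ℕ} {c : ℕ → Cl k n} (hc : c ∈ R k n M hM N) :
    nor N c = c := by
  rw [mem_R] at hc
  have : (fun j => tau j (c N)) = 0 := funext hc.2
  rw [nor, this, actF_zero]

theorem nor_act {M : ℤ} (hM : Even M) (hM0 : 0 < M) {N : ℕ} {c : ℕ → Cl k n} (hc : Flag M N c)
    (g : Fin k → ZMod 2) : nor N (actF g c) = nor N c := by
  have : (fun j => tau j (actF g c N)) = (fun j => tau j (c N)) + g :=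
    funext fun j => tau_act hM0 (hc.V hM le_rfl) g j
  rw [nor, this, actF_actF, add_assoc, add_self_fun, add_zero, nor]

theorem sum_zero {M : ℤ} (hM : Even M) (hM0 : 0 < M) {N : ℕ} (hN : 1 ≤ N)
    (φ : (ℕ → Cl k n) → ZMod 2)
    (hφ : ∀ c, Flag M N c → ∀ g, φ (actF g c) = φ c) (r : ℕ) (hr : r ≤ N)
    (hφr : ∀ c c' : ℕ → Cl k n, (∀ s, s ≠ r → c' s = c s) → φ c' = φ c) :
    ∑ c ∈ R k n M hM N, φ c = 0 := by
  have hthin := fun (c : ℕ → Cl k n) (hc : Flag M N c) => hc.thin hM hM0 hN hr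
  choose! σ h1 h2 h3 h4 using hthin
  have hinv : ∀ c, Flag M N c → σ (σ c) = c := by
    intro c hc
    have hag : ∀ s, s ≠ r → σ (σ c) s = c s := fun s hs => by
      rw [h3 _ (h1 c hc) s hs, h3 c hc s hs]
    rcases h4 c hc _ (h1 _ (h1 c hc)) hag with h | h
    · exact h
    · exact absurd h (h2 _ (h1 c hc))
  have hcomm : ∀ c, Flag M N c → ∀ g, σ (actF g c) = actF g (σ c) := by
    intro c hc g
    have hag : ∀ s, s ≠ r → actF g (σ c) s = actF g c s := fun s hs => by
      simp only [actF]; rw [h3 c hc s hs]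
    rcases h4 _ (hc.actF g) _ ((h1 c hc).actF g) hag with h | h
    · exfalso
      apply h2 c hc
      have := congrArg (actF g) h
      simpa [actF_actF, add_self_fun, actF_zero] using this
    · exact h.symm
  refine Finset.sum_involution (fun c _ => nor N (σ c)) ?_ ?_ ?_ ?_
  · intro c hc
    have hc' := (mem_R.1 hc).1
    rw [nor, hφ _ (h1 c hc'), hφr c (σ c) (h3 c hc')]
    exact CharTwo.add_self_eq_zero _
  · intro c hc _ heq
    have hc' := (mem_R.1 hc).1
    obtain ⟨s, hs, hsN⟩ : ∃ s, s ≠ r ∧ s ≤ N := by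
      by_cases h : r = 0
      · exact ⟨1, by omega, hN⟩
      · exact ⟨0, by omega, by omega⟩
    have h5 := congrFun heq s
    simp only [nor, actF] at h5
    rw [h3 c hc' s hs] at h5
    have h6 := act_eq_self hM0 (hc'.V hM hsN) h5
    rw [nor, h6, actF_zero] at heq
    exact h2 c hc' heq
  · intro c hc
    exact nor_mem hM0 (h1 c (mem_R.1 hc).1)
  · intro c hc
    have hc' := (mem_R.1 hc).1
    change nor N (σ (nor N (σ c))) = c
    rw [show nor N (σ c) = actF _ (σ c) from rfl, hcomm _ (h1 c hc'), hinv c hc', nor_act hM hM0 hc',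
      nor_of_mem hc]

end BU
namespace BU
variable {k n : ℕ}

theorem edge_act {M : ℤ} {a : Fin k → ZMod 2} {s : Cl k n → ZMod 2} (hs : Equi M a s)
    {x y : Cl k n} (hx : V M x) (hy : V M y) (g : Fin k → ZMod 2) :
    s (act g x) + s (act g y) = s x + s y := by
  rw [hs x hx g, hs y hy g]
  have := CharTwo.add_self_eq_zero (∑ j, a j * g j)
  linear_combination this

/-- the shifted product -/
def PP (N i : ℕ) (s : ℕ → Cl k n → ZMod 2) (u : ℕ → ℕ) (c : ℕ → Cl k n) : ZMod 2 :=
  ∏ l ∈ (Finset.range N).erase i, (s l (c (u l)) + s l (c (u l + 1)))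

theorem PP_act {M : ℤ} (hM : Even M) {N i : ℕ} {a : ℕ → Fin k → ZMod 2}
    {s : ℕ → Cl k n → ZMod 2} (hs : ∀ l < N, Equi M (a l) (s l)) {u : ℕ → ℕ}
    (hu : ∀ l < N, l ≠ i → u l + 1 ≤ N) {c : ℕ → Cl k n} (hc : Flag M N c) (g : Fin k → ZMod 2) :
    PP N i s u (actF g c) = PP N i s u c := by
  refine Finset.prod_congr rfl fun l hl => ?_
  simp only [Finset.mem_erase, Finset.mem_range] at hl
  have := hu l hl.2 hl.1
  exact edge_act (hs l hl.2) (hc.V hM (by omega)) (hc.V hM (by omega)) g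

theorem base_sum {M : ℤ} (hM : Even M) (hM0 : 0 < M) {N : ℕ} (hN : 1 ≤ N) {i : ℕ}
    {a : ℕ → Fin k → ZMod 2}
    {s : ℕ → Cl k n → ZMod 2} (hs : ∀ l < N, Equi M (a l) (s l))
    {t : Cl k n → ZMod 2} (ht : Equi M 0 t) {w : ℕ} (hw : w ≤ N)
    {u : ℕ → ℕ} (hu : ∀ l < N, l ≠ i → u l + 1 ≤ N) (r : ℕ) (hr : r ≤ N) (hwr : w ≠ r)
    (hur : ∀ l < N, l ≠ i → u l ≠ r ∧ u l + 1 ≠ r) :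
    ∑ c ∈ R k n M hM N, t (c w) * PP N i s u c = 0 := by
  refine sum_zero hM hM0 hN _ ?_ r hr ?_
  · intro c hc g
    rw [PP_act hM hs hu hc]
    congr 1
    have := ht (c w) (hc.V hM hw) g
    simpa [actF] using this
  · intro c c' hag
    rw [hag w hwr]
    congr 1
    refine Finset.prod_congr rfl fun l hl => ?_
    simp only [Finset.mem_erase, Finset.mem_range] at hl
    have := hur l hl.2 hl.1
    rw [hag _ this.1, hag _ this.2]

theorem swap_sum {M : ℤ} (hM : Even M) (hM0 : 0 < M) {N : ℕ} (hN : 1 ≤ N) {i : ℕ}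
    {a : ℕ → Fin k → ZMod 2}
    {s : ℕ → Cl k n → ZMod 2} (hs : ∀ l < N, Equi M (a l) (s l))
    {t : Cl k n → ZMod 2} (ht : Equi M 0 t) {w : ℕ} (hw : w ≤ N)
    {u u' : ℕ → ℕ} (hu : ∀ l < N, l ≠ i → u l + 1 ≤ N) (hu' : ∀ l < N, l ≠ i → u' l + 1 ≤ N)
    (r v : ℕ) (hr : r < N) (hri : r ≠ i) (huu : ∀ l, l ≠ r → u' l = u l)
    (h1 : u r = v) (h2 : u' r = v + 1) (hwv : w ≠ v + 1)
    (h3 : ∀ l < N, l ≠ i → l ≠ r → u l ≠ v + 1 ∧ u l + 1 ≠ v + 1) :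
    ∑ c ∈ R k n M hM N, t (c w) * PP N i s u c = ∑ c ∈ R k n M hM N, t (c w) * PP N i s u' c := by
  rw [← sub_eq_zero, CharTwo.sub_eq_add, ← Finset.sum_add_distrib]
  have hmem : r ∈ (Finset.range N).erase i := by simp [hr, hri]
  have hkey : ∀ c : ℕ → Cl k n, t (c w) * PP N i s u c + t (c w) * PP N i s u' c =
      t (c w) * ((s r (c v) + s r (c (v+2))) *
        ∏ l ∈ ((Finset.range N).erase i).erase r, (s l (c (u l)) + s l (c (u l + 1)))) := by
    intro c
    have e1 : PP N i s u c = (s r (c v) + s r (c (v+1))) *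
        ∏ l ∈ ((Finset.range N).erase i).erase r, (s l (c (u l)) + s l (c (u l + 1))) := by
      rw [PP, ← Finset.mul_prod_erase _ _ hmem, h1]
    have e2 : PP N i s u' c = (s r (c (v+1)) + s r (c (v+2))) *
        ∏ l ∈ ((Finset.range N).erase i).erase r, (s l (c (u l)) + s l (c (u l + 1))) := by
      rw [PP, ← Finset.mul_prod_erase _ _ hmem, h2]
      congr 1
      refine Finset.prod_congr rfl fun l hl => ?_
      rw [huu l (Finset.ne_of_mem_erase hl)]
    rw [e1, e2]
    have := CharTwo.add_self_eq_zero (s r (c (v+1)))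
    linear_combination (t (c w) * ∏ l ∈ ((Finset.range N).erase i).erase r,
      (s l (c (u l)) + s l (c (u l + 1)))) * this
  refine sum_zero hM hM0 hN _ ?_ (v+1) ?_ ?_
  · intro c hc g
    rw [PP_act hM hs hu hc, PP_act hM hs hu' hc]
    have := ht (c w) (hc.V hM hw) g
    simp only [Pi.zero_apply, zero_mul, Finset.sum_const_zero, add_zero] at this
    simp only [actF, this]
  · have := hu' r hr hri
    omega
  · intro c c' hag
    rw [hkey, hkey, hag w hwv, hag v (by omega), hag (v+2) (by omega)]
    congr 2
    refine Finset.prod_congr rfl fun l hl => ?_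
    simp only [Finset.mem_erase, Finset.mem_range] at hl
    have := h3 l hl.2.2 hl.2.1 hl.1
    rw [hag _ this.1, hag _ this.2]

theorem up_sum {M : ℤ} (hM : Even M) (hM0 : 0 < M) {N : ℕ} {i : ℕ} (hi : i < N)
    {a : ℕ → Fin k → ZMod 2}
    {s : ℕ → Cl k n → ZMod 2} (hs : ∀ l < N, Equi M (a l) (s l))
    {t : Cl k n → ZMod 2} (ht : Equi M 0 t) :
    ∑ c ∈ R k n M hM N, t (c (i+1)) * PP N i s id c = 0 := by
  have key : ∀ r ≤ i, ∑ c ∈ R k n M hM N,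
      t (c (i+1)) * PP N i s (fun l => if r ≤ l ∧ l < i then l + 1 else l) c = 0 := by
    intro r
    induction r with
    | zero =>
      intro _
      refine base_sum hM hM0 (by omega) hs ht (by omega) ?_ 0 (by omega) (by omega) ?_
      · intro l hl hli; split_ifs <;> omega
      · intro l hl hli; split_ifs <;> omega
    | succ r ih =>
      intro hr
      rw [← ih (by omega)]
      refine swap_sum hM hM0 (by omega) hs ht (by omega) ?_ ?_ r r (by omega) (by omega) ?_ ?_ ?_
        (by omega) ?_
      · intro l hl hli; split_ifs <;> omega
      · intro l hl hli; split_ifs <;> omega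
      · intro l hl; split_ifs <;> omega
      · split_ifs <;> omega
      · split_ifs <;> omega
      · intro l hl hli; split_ifs <;> omega
  have := key i le_rfl
  rw [← this]
  refine Finset.sum_congr rfl fun c _ => ?_
  congr 2
  funext l
  rw [if_neg (by omega)]; rfl

theorem down_sum {M : ℤ} (hM : Even M) (hM0 : 0 < M) {N : ℕ} {i : ℕ} (hi : i < N)
    {a : ℕ → Fin k → ZMod 2}
    {s : ℕ → Cl k n → ZMod 2} (hs : ∀ l < N, Equi M (a l) (s l))
    {t : Cl k n → ZMod 2} (ht : Equi M 0 t) :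
    ∑ c ∈ R k n M hM N, t (c i) * PP N i s id c = 0 := by
  have key : ∀ q r, q + r + 1 = N → i ≤ r → ∑ c ∈ R k n M hM N,
      t (c i) * PP N i s (fun l => if i < l ∧ l ≤ r then l - 1 else l) c = 0 := by
    intro q
    induction q with
    | zero =>
      intro r hr hir
      refine base_sum hM hM0 (by omega) hs ht (by omega) ?_ N (by omega) (by omega) ?_
      · intro l hl hli; split_ifs <;> omega
      · intro l hl hli; split_ifs <;> omega
    | succ q ih =>
      intro r hr hir
      rw [← ih (r+1) (by omega) (by omega)]
      symm
      refine swap_sum hM hM0 (by omega) hs ht (by omega) ?_ ?_ (r+1) r (by omega) (by omega) ?_ ?_ ?_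
        (by omega) ?_
      · intro l hl hli; split_ifs <;> omega
      · intro l hl hli; split_ifs <;> omega
      · intro l hl; split_ifs <;> omega
      · split_ifs <;> omega
      · split_ifs <;> omega
      · intro l hl hli; split_ifs <;> omega
  have := key (N - i - 1) i (by omega) le_rfl
  rw [← this]
  refine Finset.sum_congr rfl fun c _ => ?_
  congr 2
  funext l
  rw [if_neg (by omega)]; rfl

noncomputable def SS (M : ℤ) (hM : Even M) (N : ℕ) (s : ℕ → Cl k n → ZMod 2) : ZMod 2 :=
  ∑ c ∈ R k n M hM N, ∏ l ∈ Finset.range N, (s l (c l) + s l (c (l + 1)))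

theorem Equi.add {M : ℤ} {a a' : Fin k → ZMod 2} {s s' : Cl k n → ZMod 2} (hs : Equi M a s)
    (hs' : Equi M a' s') : Equi M (a + a') (fun x => s x + s' x) := by
  intro x hx g
  dsimp only
  rw [hs x hx g, hs' x hx g]
  simp only [Pi.add_apply, add_mul, Finset.sum_add_distrib]
  ring

theorem SS_one {M : ℤ} (hM : Even M) (hM0 : 0 < M) {N : ℕ} {i : ℕ} (hi : i < N)
    {a : ℕ → Fin k → ZMod 2}
    {s s' : ℕ → Cl k n → ZMod 2} (hs : ∀ l < N, Equi M (a l) (s l)) (hs' : Equi M (a i) (s' i))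
    (hss : ∀ l, l ≠ i → s' l = s l) : SS M hM N s = SS M hM N s' := by
  have ht : Equi M 0 (fun x => s i x + s' i x) := by
    have := (hs i hi).add hs'
    rwa [add_self_fun] at this
  have h1 := up_sum hM hM0 hi hs ht
  have h2 := down_sum hM hM0 hi hs ht
  rw [← sub_eq_zero, CharTwo.sub_eq_add, SS, SS, ← Finset.sum_add_distrib]
  rw [← add_zero (0 : ZMod 2)]
  nth_rewrite 1 [← h1]
  rw [← h2, ← Finset.sum_add_distrib]
  refine Finset.sum_congr rfl fun c _ => ?_
  have hmem : i ∈ Finset.range N := by simp [hi]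
  have e : ∏ l ∈ (Finset.range N).erase i, (s' l (c l) + s' l (c (l + 1))) =
      ∏ l ∈ (Finset.range N).erase i, (s l (c l) + s l (c (l + 1))) :=
    Finset.prod_congr rfl fun l hl => by rw [hss l (Finset.ne_of_mem_erase hl)]
  rw [← Finset.mul_prod_erase _ _ hmem, ← Finset.mul_prod_erase _ _ hmem, e]
  simp only [PP, id]
  ring

theorem SS_congr {M : ℤ} (hM : Even M) (hM0 : 0 < M) {N : ℕ} {a : ℕ → Fin k → ZMod 2}
    {s s' : ℕ → Cl k n → ZMod 2} (hs : ∀ l < N, Equi M (a l) (s l))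
    (hs' : ∀ l < N, Equi M (a l) (s' l)) : SS M hM N s = SS M hM N s' := by
  have key : ∀ r ≤ N, SS M hM N s = SS M hM N (fun l => if l < r then s' l else s l) := by
    intro r
    induction r with
    | zero => intro _; simp
    | succ r ih =>
      intro hr
      rw [ih (by omega)]
      refine SS_one hM hM0 (i := r) (by omega) (a := a) ?_ ?_ ?_
      · intro l hl
        split_ifs
        · exact hs' l hl
        · exact hs l hl
      · simpa using hs' r (by omega)
      · intro l hl
        split_ifs <;> first | rfl | omega
  rw [key N le_rfl]
  refine Finset.sum_congr rfl fun c _ => Finset.prod_congr rfl fun l hl => ?_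
  simp [Finset.mem_range.1 hl]

end BU
namespace BU
variable {k n : ℕ}

def bit (z : ℤ) : ZMod 2 := if z < 0 then 1 else 0

theorem bit_neg {z : ℤ} (hz : z ≠ 0) : bit (-z) = bit z + 1 := by
  unfold bit
  rcases lt_or_gt_of_ne hz with h | h
  · rw [if_neg (by omega), if_pos h]; decide
  · rw [if_pos (by omega), if_neg (by omega)]; decide

noncomputable def sg (j : Fin k) (p : Fin (n+1)) (x : Cl k n) : ZMod 2 :=
  if x (j,p) ≠ 0 then bit (x (j,p)) else
    if x (j,Fin.last n) ≠ 0 then bit (x (j,Fin.last n)) else tau j x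

theorem sg_equi {M : ℤ} (hM0 : 0 < M) (j : Fin k) (p : Fin (n+1)) :
    Equi M (Pi.single j 1) (sg j p) := by
  intro x hx g
  have hsum : ∑ j', (Pi.single j 1 : Fin k → ZMod 2) j' * g j' = g j := by
    rw [Finset.sum_eq_single j]
    · simp
    · intro b _ hb; simp [hb]
    · simp
  rw [hsum]
  unfold sg
  rw [tau_act hM0 hx g j]
  rcases zmod2_cases (g j) with h | h
  · simp [act, h]
  · have h1 : ∀ q, act g x (j,q) = - x (j,q) := fun q => by simp [act, h]
    simp only [h1, neg_ne_zero, h]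
    split_ifs with h2 h3
    · exact bit_neg h2
    · exact bit_neg h3
    · rfl

theorem tau_equi {M : ℤ} (hM0 : 0 < M) (j : Fin k) :
    Equi (n := n) M (Pi.single j 1) (tau j) := by
  intro x hx g
  have hsum : ∑ j', (Pi.single j 1 : Fin k → ZMod 2) j' * g j' = g j := by
    rw [Finset.sum_eq_single j]
    · simp
    · intro b _ hb; simp [hb]
    · simp
  rw [hsum, tau_act hM0 hx g j]

theorem sg_const {M : ℤ} (hM : Even M) (hM0 : 0 < M) {N : ℕ} {c : ℕ → Cl k n} (hc : Flag M N c)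
    {j : Fin k} {q : Fin (n+1)} (hq : |c N (j,q)| = M) {r s : ℕ} (hr : r ≤ N) (hs : s ≤ N) :
    sg j q (c r) = sg j q (c s) := by
  have h1 := hc.const hM hq hr
  have h2 := hc.const hM hq hs
  have h3 : c N (j,q) ≠ 0 := by
    intro h; rw [h] at hq; simp at hq; omega
  simp [sg, h1, h2, h3]

theorem SS_eq_zero {M : ℤ} (hM : Even M) (hM0 : 0 < M) {N : ℕ} (J : ℕ → Fin k)
    (p : ℕ → Fin (n+1)) (j : Fin k) (h : ∀ q, ∃ l < N, J l = j ∧ p l = q) :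
    SS M hM N (fun l => sg (J l) (p l)) = 0 := by
  refine Finset.sum_eq_zero fun c hc => ?_
  have hc' := (mem_R.1 hc).1
  obtain ⟨q, hq, -⟩ := hc'.top j
  obtain ⟨l, hl, rfl, rfl⟩ := h q
  refine Finset.prod_eq_zero (Finset.mem_range.2 hl) ?_
  dsimp only
  rw [sg_const hM hM0 hc' hq (by omega : l ≤ N) (by omega : l + 1 ≤ N)]
  exact CharTwo.add_self_eq_zero _

open Classical in
noncomputable def cs (M : ℤ) (N : ℕ) (J : ℕ → Fin k) (p : ℕ → Fin (n+1)) : ℕ → Cl k n :=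
  fun r i => if N < r then 0 else if i.2 = Fin.last n then -M else
    if ∃ l < r, (J l, p l) = i then 1 else 0

theorem lv_neg {j : Fin k} {x : Cl k n} (h : x (j,0) < 0) : lv j x < 0 :=
  ⟨0, fun i hi => absurd hi (Fin.not_lt_zero i), h⟩

theorem lv_pos {j : Fin k} {x : Cl k n} (h : 0 < x (j,0)) : 0 < lv j x :=
  ⟨0, fun i hi => absurd hi (Fin.not_lt_zero i), h⟩

theorem SS_eq_one {M : ℤ} (hM : Even M) (hM0 : 0 < M) (hn : 1 ≤ n) {N : ℕ} (J : ℕ → Fin k)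
    (p : ℕ → Fin (n+1)) (hlast : ∀ l < N, p l ≠ Fin.last n)
    (hinj : ∀ l < N, ∀ l' < N, J l = J l' → p l = p l' → l = l')
    (hsurj : ∀ j q, q ≠ Fin.last n → ∃ l < N, J l = j ∧ p l = q) :
    SS M hM N (fun l => sg (J l) (p l)) = 1 := by
  have h0last : (0 : Fin (n+1)) ≠ Fin.last n := by
    intro h
    have := congrArg Fin.val h
    simp at this
    omega
  -- values of the special flag
  have cs_last : ∀ r ≤ N, ∀ j, cs M N J p r (j, Fin.last n) = -M := by
    intro r hr j
    simp [cs, not_lt.2 hr]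
  have cs_one : ∀ r ≤ N, ∀ l < r, cs M N J p r (J l, p l) = 1 := by
    intro r hr l hl
    have h1 : ∃ l' < r, (J l', p l') = (J l, p l) := ⟨l, hl, rfl⟩
    simp only [cs, not_lt.2 hr, if_false, hlast l (by omega), if_pos h1]
  have cs_zero : ∀ r ≤ N, ∀ l < N, r ≤ l → cs M N J p r (J l, p l) = 0 := by
    intro r hr l hl hrl
    have h1 : ¬ ∃ l' < r, (J l', p l') = (J l, p l) := by
      rintro ⟨l', h1, h2⟩
      simp only [Prod.mk.injEq] at h2
      have := hinj l' (by omega) l hl h2.1 h2.2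
      omega
    simp only [cs, not_lt.2 hr, if_false, hlast l (by omega), if_neg h1]
  have cases_i : ∀ i : Fin k × Fin (n+1), i.2 = Fin.last n ∨ ∃ l < N, i = (J l, p l) := by
    rintro ⟨j, q⟩
    by_cases hq : q = Fin.last n
    · left; exact hq
    · right
      obtain ⟨l, hl, rfl, rfl⟩ := hsurj j q hq
      exact ⟨l, hl, rfl⟩
  have hflag : Flag M N (cs M N J p) := by
    refine ⟨?_, ?_, ?_, ?_⟩
    · intro i
      rcases cases_i i with h | ⟨l, hl, rfl⟩
      · obtain ⟨j, q⟩ := i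
        simp only at h
        subst h
        rw [cs_last 0 (by omega)]
        simpa using hM
      · rw [cs_zero 0 (by omega) l hl (by omega)]
        simp
    · intro r hr
      refine ⟨(J r, p r), 1, by simp, ?_, ?_⟩
      · rw [cs_zero r (by omega) r hr le_rfl]; simp
      · rw [cs_zero r (by omega) r hr le_rfl]
        funext i
        rcases cases_i i with h | ⟨l, hl, rfl⟩
        · obtain ⟨j, q⟩ := i
          simp only at h
          subst h
          rw [Function.update_of_ne, cs_last _ (by omega), cs_last _ (by omega)]
          intro h
          have := congrArg Prod.snd h
          exact hlast r hr this.symm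
        · by_cases hlr : l = r
          · subst hlr
            rw [cs_one _ (by omega) l (by omega)]
            simp
          · rw [Function.update_of_ne]
            · by_cases h : l < r
              · rw [cs_one _ (by omega) l (by omega), cs_one _ (by omega) l (by omega)]
              · rw [cs_zero _ (by omega) l hl (by omega), cs_zero _ (by omega) l hl (by omega)]
            · intro h
              simp only [Prod.mk.injEq] at h
              exact hlr (hinj l hl r hr h.1 h.2)
    · intro j
      refine ⟨Fin.last n, ?_, ?_⟩
      · rw [cs_last N le_rfl, abs_neg, abs_of_pos hM0]
      · intro q hq
        obtain ⟨l, hl, rfl, rfl⟩ := hsurj j q hq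
        rw [cs_one N le_rfl l hl]
        refine ⟨by decide, ?_⟩
        have : M ≠ 1 := by rintro rfl; simp at hM
        simp
        omega
    · intro r hr
      funext i
      simp [cs, hr]
  have hmem : cs M N J p ∈ R k n M hM N := by
    rw [mem_R]
    refine ⟨hflag, fun j => ?_⟩
    obtain ⟨l, hl, rfl, hp⟩ := hsurj j 0 h0last
    have h1 := cs_one N le_rfl l hl
    rw [hp] at h1
    exact tau_zero (not_lt.2 (lv_pos (by rw [h1]; norm_num)).le)
  rw [SS, Finset.sum_eq_single (cs M N J p)]
  · refine Finset.prod_eq_one fun l hl => ?_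
    have hl' := Finset.mem_range.1 hl
    have h1 := cs_one (l+1) (by omega) l (by omega)
    have h2 := cs_zero l (by omega) l hl' le_rfl
    have h3 := cs_last l (by omega) (J l)
    simp only [sg, h1, h2, h3]
    simp [bit, hM0, hM0.ne']
  · intro c hc hne
    by_contra hprod
    apply hne
    have hcF := (mem_R.1 hc).1
    have hcT := (mem_R.1 hc).2
    rw [← ne_eq, Finset.prod_ne_zero_iff] at hprod
    have H1 : ∀ j, |c N (j, Fin.last n)| = M := by
      intro j
      obtain ⟨q, hq, -⟩ := hcF.top j
      by_cases hql : q = Fin.last n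
      · rw [← hql]; exact hq
      · exfalso
        obtain ⟨l, hl, rfl, rfl⟩ := hsurj j q hql
        apply hprod l (Finset.mem_range.2 hl)
        rw [sg_const hM hM0 hcF hq (by omega : l ≤ N) (by omega : l + 1 ≤ N)]
        exact CharTwo.add_self_eq_zero _
    have H2 : ∀ l < N, c l (J l, p l) = 0 ∧
        c (l+1) (J l, p l) = if c N (J l, Fin.last n) < 0 then 1 else -1 := by
      intro l hl
      have e1 := hcF.const hM (H1 (J l)) (by omega : l ≤ N)
      have e2 := hcF.const hM (H1 (J l)) (by omega : l + 1 ≤ N)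
      have hη : c N (J l, Fin.last n) ≠ 0 := by
        intro h
        have := H1 (J l)
        rw [h] at this
        simp at this
        omega
      have hp := hprod l (Finset.mem_range.2 hl)
      have hle := (hcF.step l hl).le (J l, p l)
      generalize c N (J l, Fin.last n) = η at *
      simp only [sg, e1, e2] at hp
      generalize c l (J l, p l) = a at *
      generalize c (l+1) (J l, p l) = b at *
      rcases hle with rfl | ⟨ha, hb, hab⟩
      · rw [if_pos hη, if_pos hη] at hp
        exact absurd (CharTwo.add_self_eq_zero _) hp
      · have hb0 : b ≠ 0 := by rintro rfl; simp at hb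
        rw [if_pos hb0, if_pos hη] at hp
        by_cases ha0 : a = 0
        · subst ha0
          refine ⟨rfl, ?_⟩
          simp only [ne_eq, not_true_eq_false, if_false, bit] at hp
          rcases hab with rfl | rfl
          · split_ifs with h
            · rfl
            · simp [h] at hp
          · split_ifs with h
            · exfalso
              simp [h] at hp
              exact hp (by decide)
            · rfl
        · exfalso
          rw [if_pos ha0] at hp
          apply hp
          have : (b < 0) ↔ (a < 0) := by grind
          simp only [bit, this]
          exact CharTwo.add_self_eq_zero _
    have H3 : ∀ j, c N (j, Fin.last n) = -M := by
      intro j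
      obtain ⟨l, hl, rfl, hp⟩ := hsurj j 0 h0last
      have h2 := (H2 l hl).2
      have hle := hcF.le (by omega : l + 1 ≤ N) le_rfl (J l, p l)
      have hneg : c N (J l, Fin.last n) < 0 := by
        by_contra hcon
        rw [if_neg hcon] at h2
        have h3 : c N (J l, p l) = -1 := by
          rw [h2] at hle
          rcases hle with h | h
          · exact h.symm
          · exact absurd h.1 (by decide)
        rw [hp] at h3
        have h4 := tau_one (lv_neg (by rw [h3]; norm_num) : lv (J l) (c N) < 0)
        rw [hcT] at h4
        exact absurd h4 (by decide)
      have := H1 (J l)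
      rw [abs_of_neg hneg] at this
      omega
    funext r
    by_cases hr : N < r
    · rw [hcF.out r hr, hflag.out r hr]
    · funext i
      have hr' : r ≤ N := by omega
      rcases cases_i i with h | ⟨l, hl, rfl⟩
      · obtain ⟨j, q⟩ := i
        simp only at h
        subst h
        rw [cs_last r hr', hcF.const hM (H1 j) hr', H3]
      · have h2 := H2 l hl
        rw [H3, if_pos (by omega)] at h2
        by_cases hlr : l < r
        · rw [cs_one r hr' l hlr]
          have hle := hcF.le (by omega : l + 1 ≤ r) hr' (J l, p l)
          rw [h2.2] at hle
          rcases hle with h | h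
          · exact h.symm
          · exact absurd h.1 (by decide)
        · rw [cs_zero r hr' l hl (by omega)]
          have hle := hcF.le (by omega : r ≤ l) (by omega) (J l, p l)
          rw [h2.1] at hle
          rcases hle with h | h
          · exact h
          · exact absurd h.2.1 (by decide)
  · intro h; exact absurd hmem h

def ext {N : ℕ} {α : Type*} (d : α) (J : Fin N → α) (l : ℕ) : α :=
  if h : l < N then J ⟨l, h⟩ else d

theorem ext_val {N : ℕ} {α : Type*} (d : α) (J : Fin N → α) (l : Fin N) : ext d J l = J l := by
  simp [ext]

theorem SS_tau {M : ℤ} (hM : Even M) (hM0 : 0 < M) (hn : 1 ≤ n) (d : Fin k)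
    (J : Fin (n * k) → Fin k) :
    SS (n := n) M hM (n * k) (fun l => tau (ext d J l)) =
      if ∀ j, Fintype.card {l // J l = j} = n then 1 else 0 := by
  have hrep : ∀ p : Fin (n*k) → Fin (n+1), SS (n := n) M hM (n * k) (fun l => tau (ext d J l)) =
      SS (n := n) M hM (n * k) (fun l => sg (ext d J l) (ext 0 p l)) := fun p =>
    SS_congr hM hM0 (a := fun l => Pi.single (ext d J l) 1) (fun l _ => tau_equi hM0 _)
      (fun l _ => sg_equi hM0 _ _)
  split_ifs with hall
  · have e : ∀ j, {l // J l = j} ≃ Fin n := fun j => Fintype.equivFinOfCardEq (hall j)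
    rw [hrep (fun l => (e (J l) ⟨l, rfl⟩).castSucc)]
    refine SS_eq_one hM hM0 hn _ _ ?_ ?_ ?_
    · intro l hl
      simp only [ext, hl, dif_pos]
      exact Fin.castSucc_ne_last _
    · intro l hl l' hl' h1 h2
      simp only [ext, hl, hl', dif_pos] at h1 h2
      have h3 := Fin.castSucc_injective _ h2
      have key : ∀ (j j' : Fin k) (x : {l // J l = j}) (y : {l // J l = j'}), j = j' →
          e j x = e j' y → x.1 = y.1 := by
        rintro j _ x y rfl h
        rw [(e j).injective h]
      have := key _ _ _ _ h1 h3
      simpa using this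
    · intro j q hq
      obtain ⟨q', rfl⟩ := Fin.exists_castSucc_eq.2 hq
      obtain ⟨⟨l, hl⟩, rfl⟩ := (e j).surjective q'
      refine ⟨l, l.2, ?_, ?_⟩
      · rw [ext_val, hl]
      · rw [ext_val]
        subst hl
        rfl
  · obtain ⟨j, hj⟩ : ∃ j, n + 1 ≤ Fintype.card {l // J l = j} := by
      by_contra hcon
      push Not at hcon hall
      obtain ⟨j0, hj0⟩ := hall
      have h1 : ∑ j, Fintype.card {l // J l = j} = n * k := by
        rw [← Fintype.card_sigma, Fintype.card_congr (Equiv.sigmaFiberEquiv J), Fintype.card_fin]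
      have h2 : ∑ j, Fintype.card {l // J l = j} < ∑ j : Fin k, n := by
        refine Finset.sum_lt_sum (fun j _ => ?_) ⟨j0, Finset.mem_univ _, ?_⟩
        · have := hcon j; omega
        · have := hcon j0; omega
      rw [h1] at h2
      simp [mul_comm] at h2
    obtain ⟨φ⟩ : Nonempty (Fin (n+1) ↪ {l // J l = j}) :=
      Function.Embedding.nonempty_of_card_le (by simpa using hj)
    have hinj : Function.Injective (fun q => (φ q).1) :=
      Subtype.val_injective.comp φ.injective
    rw [hrep (Function.invFun (fun q => (φ q).1))]
    refine SS_eq_zero hM hM0 _ _ j ?_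
    intro q
    refine ⟨(φ q).1, (φ q).1.2, ?_, ?_⟩
    · rw [ext_val, (φ q).2]
    · rw [ext_val]
      exact Function.leftInverse_invFun hinj q

end BU
namespace BU
variable {k n : ℕ}

theorem coeff_identity
    (h : Fin (n * k) → Fin k → Bool)
    (hpoly :
      (∏ i : Fin (n * k), ∑ j : Fin k,
          (if h i j then (X j : MvPolynomial (Fin k) (ZMod 2)) else 0)) -
        (∏ j : Fin k, (X j : MvPolynomial (Fin k) (ZMod 2)) ^ n) ∈
        Ideal.span (Set.range fun j : Fin k =>
          (X j : MvPolynomial (Fin k) (ZMod 2)) ^ (n + 1))) :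
    ∑ J : Fin (n * k) → Fin k, (∏ l, if h l (J l) then (1 : ZMod 2) else 0) *
      (if ∀ j, Fintype.card {l // J l = j} = n then 1 else 0) = 1 := by
  classical
  let m : Fin k →₀ ℕ := Finsupp.equivFunOnFinite.symm fun _ => n
  have hset : (Set.range fun j : Fin k => (X j : MvPolynomial (Fin k) (ZMod 2)) ^ (n + 1)) =
      (fun s => monomial s (1 : ZMod 2)) '' (Set.range fun j : Fin k => Finsupp.single j (n+1)) := by
    rw [← Set.range_comp]
    congr 1
    funext j
    simp [X_pow_eq_monomial]
  rw [hset, mem_ideal_span_monomial_image] at hpoly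
  have h0 : coeff m ((∏ i : Fin (n * k), ∑ j : Fin k,
          (if h i j then (X j : MvPolynomial (Fin k) (ZMod 2)) else 0)) -
        (∏ j : Fin k, (X j : MvPolynomial (Fin k) (ZMod 2)) ^ n)) = 0 := by
    by_contra hne
    obtain ⟨s, ⟨j, rfl⟩, hs⟩ := hpoly m (mem_support_iff.2 hne)
    have := hs j
    simp [m] at this
  rw [coeff_sub, sub_eq_zero] at h0
  have h1 : coeff m (∏ j : Fin k, (X j : MvPolynomial (Fin k) (ZMod 2)) ^ n) = 1 := by
    have : (∏ j : Fin k, (X j : MvPolynomial (Fin k) (ZMod 2)) ^ n) = monomial m 1 := by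
      rw [monomial_eq, C_1, one_mul, Finsupp.prod_fintype]
      · simp [m]
      · simp
    rw [this, coeff_monomial, if_pos rfl]
  rw [h1, Finset.prod_univ_sum, Fintype.piFinset_univ, coeff_sum] at h0
  refine Eq.trans ?_ h0
  refine Finset.sum_congr rfl fun J _ => ?_
  have h2 : (∏ i, if h i (J i) then (X (J i) : MvPolynomial (Fin k) (ZMod 2)) else 0) =
      monomial (∑ l, Finsupp.single (J l) 1) (∏ l, if h l (J l) then (1 : ZMod 2) else 0) := by
    rw [monomial_sum_index]
    rw [map_prod, ← Finset.prod_mul_distrib]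
    refine Finset.prod_congr rfl fun l _ => ?_
    split_ifs
    · rw [C_1, one_mul]; rfl
    · rw [C_0, zero_mul]
  rw [h2, coeff_monomial]
  have h3 : (∑ l, Finsupp.single (J l) 1 = m) ↔ ∀ j, Fintype.card {l // J l = j} = n := by
    rw [Finsupp.ext_iff]
    refine forall_congr' fun j => ?_
    simp [m, Finsupp.finsetSum_apply, Finsupp.single_apply, Fintype.card_subtype]
  by_cases h4 : ∀ j, Fintype.card {l // J l = j} = n
  · rw [if_pos h4, if_pos (h3.2 h4), mul_one]
  · rw [if_neg h4, if_neg (fun h => h4 (h3.1 h)), mul_zero]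

theorem SS_h {M : ℤ} (hM : Even M) (hM0 : 0 < M) (hn : 1 ≤ n) (d : Fin k)
    (h : Fin (n * k) → Fin k → Bool)
    (hone : ∑ J : Fin (n * k) → Fin k, (∏ l, if h l (J l) then (1 : ZMod 2) else 0) *
      (if ∀ j, Fintype.card {l // J l = j} = n then 1 else 0) = 1)
    {s : ℕ → Cl k n → ZMod 2}
    (hs : ∀ l : Fin (n * k), Equi M (fun j => if h l j then 1 else 0) (s l)) :
    SS M hM (n * k) s = 1 := by
  let s' : ℕ → Cl k n → ZMod 2 :=
    fun l x => ∑ j, (ext 0 (fun l j => if h l j then (1 : ZMod 2) else 0) l) j * tau j x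
  have e1 : SS M hM (n * k) s = SS M hM (n * k) s' := by
    refine SS_congr hM hM0 (a := ext 0 (fun l j => if h l j then (1 : ZMod 2) else 0)) ?_ ?_
    · intro l hl
      have := hs ⟨l, hl⟩
      have e := ext_val 0 (fun l j => if h l j then (1 : ZMod 2) else 0) ⟨l, hl⟩
      simp only at e
      rw [e]
      exact this
    · intro l hl x hx g
      simp only [s']
      rw [← Finset.sum_add_distrib]
      refine Finset.sum_congr rfl fun j _ => ?_
      rw [tau_act hM0 hx]
      ring
  rw [e1, ← hone]
  have e2 : ∀ c : ℕ → Cl k n, ∏ l ∈ Finset.range (n*k), (s' l (c l) + s' l (c (l+1))) =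
      ∑ J : Fin (n * k) → Fin k, (∏ l, if h l (J l) then (1 : ZMod 2) else 0) *
        ∏ l ∈ Finset.range (n*k), (tau (ext d J l) (c l) + tau (ext d J l) (c (l+1))) := by
    intro c
    rw [Finset.prod_range]
    simp only [s', ext_val, ← Finset.sum_add_distrib, ← mul_add]
    rw [Finset.prod_univ_sum, Fintype.piFinset_univ]
    refine Finset.sum_congr rfl fun J _ => ?_
    rw [Finset.prod_mul_distrib, Finset.prod_range]
    simp only [ext_val]
  rw [SS]
  simp only [e2]
  rw [Finset.sum_comm]
  refine Finset.sum_congr rfl fun J _ => ?_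
  rw [← Finset.mul_sum, ← SS_tau hM hM0 hn d J]
  rfl

end BU
namespace BU
variable {k n : ℕ}

noncomputable def sgn (a : ZMod 2) : ℝ := if a = 0 then 1 else -1

theorem sgn_add (a b : ZMod 2) : sgn (a + b) = sgn a * sgn b := by
  unfold sgn
  rcases zmod2_cases a with rfl | rfl <;> rcases zmod2_cases b with rfl | rfl <;>
    simp [show (1 + 1 : ZMod 2) = 0 from by decide]

theorem sgn_cases (a : ZMod 2) : sgn a = 1 ∨ sgn a = -1 := by
  unfold sgn; split_ifs <;> simp

theorem prod_sgn (g : Fin k → ZMod 2) (T : Finset (Fin k)) :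
    ∏ j ∈ T, sgn (g j) = sgn (∑ j ∈ T, g j) := by
  classical
  induction T using Finset.induction_on with
  | empty => simp [sgn]
  | insert a T ha ih => rw [Finset.prod_insert ha, Finset.sum_insert ha, sgn_add, ih]

noncomputable def pt (M : ℤ) (x : Cl k n) : Fin k → Fin (n+1) → ℝ := fun j p => (x (j,p) : ℝ) / M

noncomputable def nu (z : Fin k → Fin (n+1) → ℝ) : Fin k → EuclideanSpace ℝ (Fin (n+1)) :=
  fun j => (‖(WithLp.toLp 2 (z j) : EuclideanSpace ℝ (Fin (n+1)))‖)⁻¹ • WithLp.toLp 2 (z j)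

def KK (k n : ℕ) : Set (Fin k → Fin (n+1) → ℝ) := {z | ∀ j, ‖z j‖ = 1}

theorem KK_compact : IsCompact (KK k n) := by
  have : KK k n = Set.pi Set.univ fun _ => Metric.sphere (0 : Fin (n+1) → ℝ) 1 := by
    ext z; simp [KK, Set.mem_pi]
  rw [this]
  exact isCompact_univ_pi fun _ => isCompact_sphere _ _

theorem toLp_ne {z : Fin k → Fin (n+1) → ℝ} (hz : z ∈ KK k n) (j : Fin k) :
    ‖(WithLp.toLp 2 (z j) : EuclideanSpace ℝ (Fin (n+1)))‖ ≠ 0 := by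
  intro h
  have h1 := hz j
  rw [norm_eq_zero] at h
  have h2 : z j = 0 := by
    funext p
    exact congrArg (fun v : EuclideanSpace ℝ (Fin (n+1)) => v p) h
  rw [h2] at h1
  simp at h1

theorem nu_norm {z : Fin k → Fin (n+1) → ℝ} (hz : z ∈ KK k n) (j : Fin k) : ‖nu z j‖ = 1 := by
  rw [nu, norm_smul, norm_inv, norm_norm]
  exact inv_mul_cancel₀ (toLp_ne hz j)

theorem nu_cont : ContinuousOn (nu (k := k) (n := n)) (KK k n) := by
  rw [continuousOn_pi]
  intro j
  have hc : Continuous fun z : Fin k → Fin (n+1) → ℝ =>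
      (WithLp.toLp 2 (z j) : EuclideanSpace ℝ (Fin (n+1))) :=
    (PiLp.continuous_toLp 2 _).comp (continuous_apply j)
  exact (hc.norm.continuousOn.inv₀ fun z hz => toLp_ne hz j).smul hc.continuousOn

theorem pt_mem {M : ℤ} (hM0 : 0 < M) {x : Cl k n} (hx : V M x) : pt M x ∈ KK k n := by
  have hMr : (0 : ℝ) < M := by exact_mod_cast hM0
  intro j
  have habs : ∀ p, ‖pt M x j p‖ = (|x (j,p)| : ℤ) / (M : ℝ) := by
    intro p
    rw [pt, norm_div, Real.norm_eq_abs, Real.norm_eq_abs, abs_of_pos hMr, Int.cast_abs]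
  apply le_antisymm
  · rw [pi_norm_le_iff_of_nonneg zero_le_one]
    intro p
    rw [habs, div_le_one hMr]
    exact_mod_cast (hx j).1 p
  · obtain ⟨p, hp⟩ := (hx j).2
    have h1 := norm_le_pi_norm (pt M x j) p
    rw [habs, hp, div_self hMr.ne'] at h1
    exact h1

theorem nu_act (M : ℤ) (g : Fin k → ZMod 2) (x : Cl k n) :
    nu (pt M (act g x)) = fun j => sgn (g j) • nu (pt M x) j := by
  funext j
  rcases zmod2_cases (g j) with h | h
  · have h1 : pt M (act g x) j = pt M x j := by
      funext p; simp [pt, act, h]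
    simp [nu, h1, h, sgn]
  · have h1 : pt M (act g x) j = - pt M x j := by
      funext p; simp [pt, act, h, neg_div]
    simp only [nu, h1, h, sgn, WithLp.toLp_neg, norm_neg]
    simp

theorem pt_dist {M : ℤ} (hM0 : 0 < M) {x y : Cl k n} (h : Le x y) :
    dist (pt M x) (pt M y) ≤ 1 / M := by
  have hMr : (0 : ℝ) < M := by exact_mod_cast hM0
  have h0 : (0 : ℝ) ≤ 1 / M := by positivity
  rw [dist_pi_le_iff h0]
  intro j
  rw [dist_pi_le_iff h0]
  intro p
  rw [Real.dist_eq, pt, pt, ← sub_div, abs_div, abs_of_pos hMr]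
  gcongr
  have : |x (j,p) - y (j,p)| ≤ 1 := by
    have := h (j,p)
    grind
  exact_mod_cast this

theorem main (n k : ℕ) (hn : 1 ≤ n) (hk : 1 ≤ k)
    (h : Fin (n * k) → Fin k → Bool)
    (hpoly :
      (∏ i : Fin (n * k), ∑ j : Fin k,
          (if h i j then (X j : MvPolynomial (Fin k) (ZMod 2)) else 0)) -
        (∏ j : Fin k, (X j : MvPolynomial (Fin k) (ZMod 2)) ^ n) ∈
        Ideal.span (Set.range fun j : Fin k =>
          (X j : MvPolynomial (Fin k) (ZMod 2)) ^ (n + 1)))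
    (f : (Fin k → EuclideanSpace ℝ (Fin (n + 1))) → Fin (n * k) → ℝ)
    (hf : ContinuousOn f {y : Fin k → EuclideanSpace ℝ (Fin (n + 1)) | ∀ j, ‖y j‖ = 1})
    (hequiv : ∀ y : Fin k → EuclideanSpace ℝ (Fin (n + 1)), (∀ j, ‖y j‖ = 1) →
      ∀ ε : Fin k → ℝ, (∀ j, ε j = 1 ∨ ε j = -1) →
      ∀ i : Fin (n * k),
        f (fun j => ε j • y j) i =
          (∏ j ∈ Finset.univ.filter fun j => h i j, ε j) * f y i) :
    ∃ y : Fin k → EuclideanSpace ℝ (Fin (n + 1)), (∀ j, ‖y j‖ = 1) ∧ f y = 0 := by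
  by_contra hcon
  push Not at hcon
  have hF : ContinuousOn (fun z => f (nu z)) (KK k n) :=
    hf.comp nu_cont fun z hz j => nu_norm hz j
  obtain ⟨δ, hδ, hmin⟩ := KK_compact.exists_forall_le' (a := 0) hF.norm
    (fun z hz => norm_pos_iff.2 (hcon _ fun j => nu_norm hz j))
  have hunif := KK_compact.uniformContinuousOn_of_continuous hF
  rw [Metric.uniformContinuousOn_iff] at hunif
  obtain ⟨η, hη, hclose⟩ := hunif δ hδ
  obtain ⟨m, hm⟩ := exists_nat_gt (1 / η)
  have hm0 : (0 : ℝ) < m := lt_trans (by positivity) hm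
  have hm0' : 0 < m := by exact_mod_cast hm0
  let M : ℤ := 2 * m
  have hM : Even M := even_two_mul _
  have hM0 : 0 < M := by simp only [M]; omega
  have hMη : 1 / (M : ℝ) < η := by
    rw [div_lt_iff₀ hη] at hm
    have hMr : (0 : ℝ) < M := by exact_mod_cast hM0
    rw [div_lt_iff₀ hMr]
    simp only [M]
    push_cast
    nlinarith
  let s0 : Fin (n * k) → Cl k n → ZMod 2 := fun l x =>
    open Classical in
    if f (nu (pt M x)) l ≠ 0 then (if f (nu (pt M x)) l < 0 then 1 else 0)
    else ∑ j, (if h l j then 1 else 0) * tau j x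
  have hs0 : ∀ l, Equi M (fun j => if h l j then 1 else 0) (s0 l) := by
    intro l x hx g
    have e1 := hequiv (nu (pt M x)) (fun j => nu_norm (pt_mem hM0 hx) j) (fun j => sgn (g j))
      (fun j => sgn_cases _) l
    rw [← nu_act, prod_sgn] at e1
    have e2 : ∑ j, (if h l j then (1 : ZMod 2) else 0) * g j =
        ∑ j ∈ Finset.univ.filter fun j => h l j, g j := by
      rw [Finset.sum_filter]
      refine Finset.sum_congr rfl fun j _ => ?_
      split_ifs <;> simp
    have e3 : ∑ j, (if h l j then (1 : ZMod 2) else 0) * tau j (act g x) =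
        ∑ j, (if h l j then (1 : ZMod 2) else 0) * tau j x +
        ∑ j, (if h l j then (1 : ZMod 2) else 0) * g j := by
      rw [← Finset.sum_add_distrib]
      refine Finset.sum_congr rfl fun j _ => ?_
      rw [tau_act hM0 hx]
      ring
    simp only [s0]
    rw [e3, e1, e2]
    generalize f (nu (pt M x)) l = w
    rcases zmod2_cases (∑ j ∈ Finset.univ.filter fun j => h l j, g j) with e | e
    · rw [e]; simp [sgn]
    · rw [e]
      simp only [sgn, one_ne_zero, if_false, neg_mul, one_mul, ne_eq, neg_eq_zero]
      by_cases hw : w = 0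
      · simp [hw]
      · simp only [hw, not_false_eq_true, if_true]
        rcases lt_or_gt_of_ne hw with h1 | h1
        · rw [if_neg (by linarith), if_pos h1]; decide
        · rw [if_pos (by linarith), if_neg (by linarith)]; decide
  have hS1 := SS_h hM hM0 hn ⟨0, hk⟩ h (coeff_identity h hpoly) (s := ext (fun _ => 0) s0)
    (fun l => by rw [ext_val]; exact hs0 l)
  have hS0 : SS M hM (n * k) (ext (fun _ => 0) s0) = 0 := by
    refine Finset.sum_eq_zero fun c hc => ?_
    have hcF := (mem_R.1 hc).1
    have hKN := pt_mem hM0 (hcF.V hM le_rfl)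
    have hbig := hmin _ hKN
    obtain ⟨l, hl⟩ : ∃ l, δ ≤ ‖f (nu (pt M (c (n*k)))) l‖ := by
      by_contra hno
      push Not at hno
      have := (pi_norm_lt_iff hδ).2 hno
      linarith
    have hsign : ∀ r ≤ n * k, f (nu (pt M (c r))) l ≠ 0 ∧
        (f (nu (pt M (c r))) l < 0 ↔ f (nu (pt M (c (n*k)))) l < 0) := by
      intro r hr
      have hKr := pt_mem hM0 (hcF.V hM hr)
      have hd := lt_of_le_of_lt (pt_dist hM0 (hcF.le hr le_rfl)) hMη
      have h1 := hclose _ hKr _ hKN hd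
      have h2 := lt_of_le_of_lt (dist_le_pi_dist _ _ l) h1
      rw [Real.dist_eq] at h2
      rw [Real.norm_eq_abs] at hl
      generalize f (nu (pt M (c r))) l = a at *
      generalize f (nu (pt M (c (n*k)))) l = b at *
      rw [abs_lt] at h2
      rcases le_abs.1 hl with h3 | h3
      · refine ⟨by intro h; linarith, ⟨fun h => by linarith, fun h => by linarith⟩⟩
      · refine ⟨by intro h; linarith, ⟨fun h => by linarith, fun h => by linarith⟩⟩
    refine Finset.prod_eq_zero (Finset.mem_range.2 l.2) ?_
    rw [ext_val]
    have h1 := hsign l l.2.le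
    have h2 := hsign (l+1) l.2
    have h3 : s0 l (c l) = s0 l (c (l+1)) := by
      simp only [s0]
      rw [if_pos h1.1, if_pos h2.1]
      by_cases h4 : f (nu (pt M (c (n*k)))) l < 0
      · rw [if_pos (h1.2.2 h4), if_pos (h2.2.2 h4)]
      · rw [if_neg (fun h => h4 (h1.2.1 h)), if_neg (fun h => h4 (h2.2.1 h))]
    rw [h3]
    exact CharTwo.add_self_eq_zero _
  rw [hS0] at hS1
  exact absurd hS1 (by decide)

end BU

/-- **Borsuk–Ulam type theorem for `(ℤ/2)^k` (Proposition 6.1 of Simon).**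
Let `h 1, …, h (n*k) ∈ {0,1}^k` and suppose that in `(ℤ/2)[u_1, …, u_k]`, the product
`∏ i, (h i 1 • u_1 + ⋯ + h i k • u_k)` is congruent to `u_1^n ⋯ u_k^n` modulo the ideal
generated by `u_1^{n+1}, …, u_k^{n+1}`. Then every continuous map
`f : (S^n)^k → ℝ^{n*k}` whose `i`-th coordinate changes sign according to the signs `ε j`
with `h i j = 1` (i.e. is equivariant for the coordinatewise antipodal `(ℤ/2)^k`-action and
the action on `ℝ^{n*k}` prescribed by `h`) has a zero. -/
theorem borsuk_ulam_zmod2k (n k : ℕ) (hn : 1 ≤ n) (hk : 1 ≤ k)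
    (h : Fin (n * k) → Fin k → Bool)
    (hpoly :
      (∏ i : Fin (n * k), ∑ j : Fin k,
          (if h i j then (X j : MvPolynomial (Fin k) (ZMod 2)) else 0)) -
        (∏ j : Fin k, (X j : MvPolynomial (Fin k) (ZMod 2)) ^ n) ∈
        Ideal.span (Set.range fun j : Fin k =>
          (X j : MvPolynomial (Fin k) (ZMod 2)) ^ (n + 1)))
    (f : (Fin k → EuclideanSpace ℝ (Fin (n + 1))) → Fin (n * k) → ℝ)
    (hf : ContinuousOn f {y : Fin k → EuclideanSpace ℝ (Fin (n + 1)) | ∀ j, ‖y j‖ = 1})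
    (hequiv : ∀ y : Fin k → EuclideanSpace ℝ (Fin (n + 1)), (∀ j, ‖y j‖ = 1) →
      ∀ ε : Fin k → ℝ, (∀ j, ε j = 1 ∨ ε j = -1) →
      ∀ i : Fin (n * k),
        f (fun j => ε j • y j) i =
          (∏ j ∈ Finset.univ.filter fun j => h i j, ε j) * f y i) :
    ∃ y : Fin k → EuclideanSpace ℝ (Fin (n + 1)), (∀ j, ‖y j‖ = 1) ∧ f y = 0 := by
  exact BU.main n k hn hk h hpoly f hf hequiv
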